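/- arXiv:math/0610480 — 2 statements merged into one kernel-verified Lean document; each statement's English description precedes it below -/
import Mathlib

section
/- Let log denote the principal branch of the complex logarithm (imaginary part in (−π, π]). There exists a constant C > 0 such that for every w ∈ ℂ with w ≠ −1, one has |log(1+w)| ≤ C·( |w| + |w/(1+w)| ) and |log(1+w) − w| ≤ C·( |w|² + |w/(1+w)|² ). -/
/-- Away from the origin, the logarithm is controlled by its real part, since the imaginary part
is bounded by `π`. -/
lemma norm_log_one_add_le_of_half_le {w : ℂ} (hw : w ≠ -1) (h : 1 / 2 ≤ ‖w‖) :
    ‖Complex.log (1 + w)‖ ≤ 9 * ‖w‖ + 2 * ‖w / (1 + w)‖ := by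
  have hne : 1 + w ≠ 0 := fun h0 ↦ hw (eq_neg_of_add_eq_zero_right h0)
  have hr : 0 < ‖1 + w‖ := norm_pos_iff.mpr hne
  have h_tri : ‖1 + w‖ ≤ 1 + ‖w‖ := by simpa using norm_add_le 1 w
  have h_upper := Real.log_le_sub_one_of_pos hr
  have h_lower := Real.one_sub_inv_le_log_of_pos hr
  have h_inv : ‖1 + w‖⁻¹ ≤ 2 * ‖w / (1 + w)‖ := by
    rw [norm_div, div_eq_mul_inv]
    nlinarith [inv_pos.mpr hr]
  have h_norm := Complex.norm_le_abs_re_add_abs_im (Complex.log (1 + w))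
  rw [Complex.log_re, Complex.log_im] at h_norm
  have h_arg := Complex.abs_arg_le_pi (1 + w)
  have h_abs : |Real.log ‖1 + w‖| ≤ ‖w‖ + 2 * ‖w / (1 + w)‖ :=
    abs_le.mpr ⟨by linarith, by linarith [norm_nonneg (w / (1 + w))]⟩
  linarith [Real.pi_le_four]

/-- Lemma 3.2. For the principal branch of the complex logarithm,
there is `C > 0` such that for all `w ≠ −1`,
`|log(1+w)| ≤ C(|w| + |w/(1+w)|)` and `|log(1+w) − w| ≤ C(|w|² + |w/(1+w)|²)`. -/
theorem statement4 :
    ∃ C > (0 : ℝ), ∀ w : ℂ, w ≠ -1 →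
      ‖Complex.log (1 + w)‖ ≤ C * (‖w‖ + ‖w / (1 + w)‖) ∧
      ‖Complex.log (1 + w) - w‖ ≤ C * (‖w‖ ^ 2 + ‖w / (1 + w)‖ ^ 2) := by
  refine ⟨24, by norm_num, fun w hw ↦ ?_⟩
  have ha := norm_nonneg w
  have hb := norm_nonneg (w / (1 + w))
  rcases le_total ‖w‖ (1 / 2) with h | h
  · refine ⟨by linarith [Complex.norm_log_one_add_half_le_self h], ?_⟩
    have h_taylor := Complex.norm_log_one_add_sub_self_le (h.trans_lt one_half_lt_one)
    have h_inv : (1 - ‖w‖)⁻¹ ≤ 2 := by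
      rw [inv_le_comm₀ (by linarith) (by norm_num)]
      linarith
    nlinarith [mul_le_mul_of_nonneg_left h_inv (sq_nonneg ‖w‖), sq_nonneg ‖w / (1 + w)‖]
  · have h_log := norm_log_one_add_le_of_half_le hw h
    refine ⟨by linarith, ?_⟩
    have h_sub := norm_sub_le (Complex.log (1 + w)) w
    nlinarith [sq_nonneg (‖w / (1 + w)‖ - 1), sq_nonneg ‖w / (1 + w)‖]
end

section
/- Let f(x) = cos√x for real x > 0. Then, as x → +∞, f(x+1) − f(x) − f'(x) + (1/(8x))·cos( (√(x+1) + 3√x)/4 ) = o(1/x); that is, x·[ f(x+1) − f(x) − f'(x) + (1/(8x))·cos( (√(x+1)+3√x)/4 ) ] → 0 as x → +∞. -/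
/-- If `d > 0` is the gap between `s` and `√(s² + 1)`, then the error of the expansion of
`cos (s + d)` around `s`, scaled by `s²`, is at most `d`. -/
theorem abs_scaled_cos_increment_error_le {s d : ℝ} (hs : 1 ≤ s) (hd : 0 < d)
    (hsd : d * (2 * s + d) = 1) :
    |s ^ 2 * (Real.cos (s + d) - Real.cos s - (-Real.sin s / (2 * s))
      + (1 / (8 * s ^ 2)) * Real.cos (s + d / 4))| ≤ d := by
  have hs0 : 0 < s := by linarith
  have hsd2 : s * d ≤ 1 / 2 := by nlinarith
  have hsd0 : 0 < s * d := mul_pos hs0 hd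
  have hd1 : d ≤ 1 / 2 := by nlinarith
  have hsd_sq : (s * d) ^ 2 ≤ 1 / 4 := by nlinarith
  have hcosCoeff : |s ^ 2 * (Real.cos d - 1) + Real.cos (d / 4) / 8| ≤ d / 2 := by
    have hcos := Real.cos_bound (x := d) (by rw [abs_of_pos hd]; linarith)
    rw [abs_of_pos hd, abs_le] at hcos
    have hquarter := Real.one_sub_sq_div_two_le_cos (x := d / 4)
    have hquarter' := Real.cos_le_one (d / 4)
    have hlow := mul_le_mul_of_nonneg_left hcos.1 (sq_nonneg s)
    have hupp := mul_le_mul_of_nonneg_left hcos.2 (sq_nonneg s)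
    have hfour : s ^ 2 * d ^ 4 ≤ d ^ 2 / 4 := by nlinarith [sq_nonneg d]
    have hmain : 1 / 8 - s ^ 2 * d ^ 2 / 2 = d ^ 2 * (1 + 2 * (s * d)) / 8 := by
      linear_combination (-(1 + 2 * (s * d)) / 8) * hsd
    have hmain_le : d ^ 2 * (1 + 2 * (s * d)) / 8 ≤ d ^ 2 / 4 := by nlinarith [sq_nonneg d]
    have hmain_nonneg : 0 ≤ d ^ 2 * (1 + 2 * (s * d)) / 8 := by positivity
    rw [abs_le]
    constructor <;> nlinarith
  have hsinCoeff : |s ^ 2 * (1 / (2 * s) - Real.sin d) - Real.sin (d / 4) / 8| ≤ d / 2 := by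
    have hsin := Real.sin_lt hd
    have hsin' := Real.sin_gt_sub_cube hd
    have hquarter := Real.sin_lt (x := d / 4) (by linarith)
    have hquarter' := Real.sin_nonneg_of_nonneg_of_le_pi (x := d / 4) (by linarith)
      (by linarith [Real.pi_gt_three])
    have hhalf : s ^ 2 * (1 / (2 * s)) = s / 2 := by field_simp
    have hmain : s / 2 - s ^ 2 * d = s * d * d / 2 := by
      linear_combination (-s / 2) * hsd
    have hmain_le : s * d * d / 2 ≤ d / 4 := by nlinarith
    have hlow := mul_le_mul_of_nonneg_left hsin.le (sq_nonneg s)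
    have hupp := mul_le_mul_of_nonneg_left hsin'.le (sq_nonneg s)
    have hcube : s ^ 2 * d ^ 3 ≤ d / 4 := by nlinarith
    have hmain_nonneg : 0 ≤ s * d * d / 2 := by positivity
    rw [mul_sub, hhalf, abs_le]
    constructor <;> nlinarith
  have hsplit : s ^ 2 * (Real.cos (s + d) - Real.cos s - (-Real.sin s / (2 * s))
      + (1 / (8 * s ^ 2)) * Real.cos (s + d / 4))
      = Real.cos s * (s ^ 2 * (Real.cos d - 1) + Real.cos (d / 4) / 8)
        + Real.sin s * (s ^ 2 * (1 / (2 * s) - Real.sin d) - Real.sin (d / 4) / 8) := by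
    rw [Real.cos_add, Real.cos_add]
    field_simp
    ring
  rw [hsplit]
  calc _ ≤ _ := abs_add_le _ _
    _ ≤ 1 * (d / 2) + 1 * (d / 2) := by
      rw [abs_mul, abs_mul]
      gcongr
      · exact Real.abs_cos_le_one s
      · exact Real.abs_sin_le_one s
    _ = d := by ring


/-- asymptotics in Example 4.1. For `f(x) = cos √x` on `(0,∞)`, with
`f'(x) = −sin(√x)/(2√x)`, one has, as `x → +∞`,
`x·[f(x+1) − f(x) − f'(x) + (1/(8x)) cos((√(x+1)+3√x)/4)] → 0`. -/
theorem statement8 :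
    Filter.Tendsto (fun x : ℝ =>
      x * (Real.cos (Real.sqrt (x + 1)) - Real.cos (Real.sqrt x)
        - (-Real.sin (Real.sqrt x) / (2 * Real.sqrt x))
        + (1 / (8 * x)) * Real.cos ((Real.sqrt (x + 1) + 3 * Real.sqrt x) / 4)))
      Filter.atTop (nhds 0) := by
  have hlim : Filter.Tendsto (fun x : ℝ => (Real.sqrt x)⁻¹) Filter.atTop (nhds 0) :=
    tendsto_inv_atTop_zero.comp Real.tendsto_sqrt_atTop
  refine squeeze_zero_norm' ?_ hlim
  filter_upwards [Filter.eventually_ge_atTop 1] with x hx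
  have hs : 1 ≤ Real.sqrt x := Real.one_le_sqrt.mpr hx
  have hd : 0 < Real.sqrt (x + 1) - Real.sqrt x :=
    sub_pos.mpr (Real.sqrt_lt_sqrt (by linarith) (by linarith))
  have hxs : Real.sqrt x ^ 2 = x := Real.sq_sqrt (by linarith)
  have hxt : Real.sqrt (x + 1) ^ 2 = x + 1 := Real.sq_sqrt (by linarith)
  have hsd : (Real.sqrt (x + 1) - Real.sqrt x)
      * (2 * Real.sqrt x + (Real.sqrt (x + 1) - Real.sqrt x)) = 1 := by
    linear_combination hxt - hxs
  have hbound := abs_scaled_cos_increment_error_le hs hd hsd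
  rw [hxs, add_sub_cancel, show Real.sqrt x + (Real.sqrt (x + 1) - Real.sqrt x) / 4
    = (Real.sqrt (x + 1) + 3 * Real.sqrt x) / 4 by ring] at hbound
  rw [Real.norm_eq_abs]
  refine hbound.trans ?_
  rw [← one_div, le_div_iff₀ (by linarith)]
  nlinarith
end
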